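/- Let N ≥ 3. There exists a constant σ_N > 0, depending only on N, such that for every open convex set Ω ⊊ ℝ^N and every u ∈ C_0^∞(Ω) one has ∫_Ω (|∇u|² − |u|²/(4 dist(x, Ω^c)²)) dx ≥ σ_N (∫_Ω |u|^{2N/(N−2)} dx)^{(N−2)/N}. In particular, the constant in the Hardy–Sobolev–Maz'ya inequality on convex domains can be chosen independently of the domain. -/

import Mathlib

open MeasureTheory Metric Set

section Auxiliary

open scoped ENNReal

/-- Cauchy–Schwarz for interval integrals of continuous functions. -/
lemma sq_intervalIntegral_mul_le {a b : ℝ} (hab : a ≤ b) {x y : ℝ → ℝ}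
    (hx : ContinuousOn x (Icc a b)) (hy : ContinuousOn y (Icc a b)) :
    (∫ s in a..b, x s * y s) ^ 2 ≤ (∫ s in a..b, x s ^ 2) * ∫ s in a..b, y s ^ 2 := by
  have hi : ∀ {z : ℝ → ℝ}, ContinuousOn z (Icc a b) → IntervalIntegrable z volume a b :=
    fun hz => ContinuousOn.intervalIntegrable (by rwa [uIcc_of_le hab])
  have key : ∀ l : ℝ, 0 ≤ (∫ s in a..b, x s ^ 2) * (l * l) + (2 * ∫ s in a..b, x s * y s) * l +
      ∫ s in a..b, y s ^ 2 := by
    intro l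
    have h0 : 0 ≤ ∫ s in a..b, (x s * l + y s) ^ 2 :=
      intervalIntegral.integral_nonneg hab fun _ _ => sq_nonneg _
    have e : ∫ s in a..b, (x s * l + y s) ^ 2 =
        ∫ s in a..b, (x s ^ 2 * (l * l) + (x s * y s) * (2 * l) + y s ^ 2) := by
      congr 1; ext s; ring
    rw [e, intervalIntegral.integral_add (hi (by fun_prop)) (hi (by fun_prop)),
      intervalIntegral.integral_add (hi (by fun_prop)) (hi (by fun_prop)),
      intervalIntegral.integral_mul_const, intervalIntegral.integral_mul_const] at h0
    linarith
  have := discrim_le_zero key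
  rw [discrim] at this
  nlinarith

/-- A sharp Hardy inequality on a half-interval, with a Gagliardo–Nirenberg remainder. -/
lemma hardy_remainder_Icc {f f' : ℝ → ℝ} {e m p : ℝ} (he : 0 < e) (hem : e ≤ m) (hp : 2 ≤ p)
    (hf : ∀ s, HasDerivAt f (f' s) s) (hf' : Continuous f') (hfe : f e = 0) :
    0 ≤ ∫ s in e..m, (f' s ^ 2 - f s ^ 2 / (4 * s ^ 2)) ∧
    ∀ t ∈ Icc e m, (|f t| ^ p) ^ 2 ≤ (2 + 3 * p) ^ 2 *
      ((∫ s in e..m, (f' s ^ 2 - f s ^ 2 / (4 * s ^ 2))) * ∫ s in e..m, (|f s| ^ (p - 1)) ^ 2) := by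
  have hm : 0 < m := he.trans_le hem
  have hfc : Continuous f := continuous_iff_continuousAt.2 fun s => (hf s).continuousAt
  have hne : ∀ s ∈ Icc e m, s ≠ 0 := fun s hs => (he.trans_le hs.1).ne'
  have hi : ∀ {z : ℝ → ℝ} {t : ℝ}, t ∈ Icc e m → ContinuousOn z (Icc e m) →
      IntervalIntegrable z volume t m := fun {z t} ht hz =>
    (hz.mono (by rw [uIcc_of_le ht.2]; exact Icc_subset_Icc_left ht.1)).intervalIntegrable
  have hee : e ∈ Icc e m := ⟨le_rfl, hem⟩
  set v : ℝ → ℝ := fun s => f' s - f s / (2 * s) with hv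
  have hvc : ContinuousOn v (Icc e m) := by
    refine hf'.continuousOn.sub (hfc.continuousOn.div (by fun_prop) ?_)
    intro s hs; have := hne s hs; positivity
  obtain ⟨P, hP⟩ : ∃ P : ℝ → ℝ, ∀ s, P s = |f s| ^ p := ⟨_, fun _ => rfl⟩
  obtain ⟨Q, hQ⟩ : ∃ Q : ℝ → ℝ, ∀ s, Q s = |f s| ^ (p - 1) := ⟨_, fun _ => rfl⟩
  obtain ⟨S, hS⟩ : ∃ S : ℝ → ℝ, ∀ s, S s = |f s| ^ (p - 2) := ⟨_, fun _ => rfl⟩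
  have hP0 : ∀ s, 0 ≤ P s := fun s => by rw [hP]; positivity
  have hQ0 : ∀ s, 0 ≤ Q s := fun s => by rw [hQ]; positivity
  have hS0 : ∀ s, 0 ≤ S s := fun s => by rw [hS]; positivity
  have hcont : ∀ {r : ℝ}, 0 ≤ r → Continuous fun s => |f s| ^ r :=
    fun hr => hfc.abs.rpow_const fun s => Or.inr hr
  have hPc : Continuous P := by rw [funext hP]; exact hcont (by linarith)
  have hQc : Continuous Q := by rw [funext hQ]; exact hcont (by linarith)
  have hSc : Continuous S := by rw [funext hS]; exact hcont (by linarith)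
  have hPQ : ∀ s, P s = Q s * |f s| := fun s => by
    rw [hP, hQ, ← Real.rpow_add_one' (abs_nonneg _) (by linarith)]; congr 1; ring
  have hQS : ∀ s, Q s = S s * |f s| := fun s => by
    rw [hQ, hS, ← Real.rpow_add_one' (abs_nonneg _) (by linarith)]; congr 1; ring
  simp only [← hP, ← hQ]
  -- the ground state representation
  have hA : ∫ s in e..m, (f' s ^ 2 - f s ^ 2 / (4 * s ^ 2)) =
      (∫ s in e..m, v s ^ 2) + f m ^ 2 / (2 * m) := by
    have hd : ∀ s ∈ uIcc e m, HasDerivAt (fun s => f s ^ 2 / (2 * s))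
        (f' s ^ 2 - f s ^ 2 / (4 * s ^ 2) - v s ^ 2) s := by
      intro s hs
      rw [uIcc_of_le hem] at hs
      have h0 := hne s hs
      refine (((hf s).pow 2).div ((hasDerivAt_id s).const_mul 2)
        (by simpa using h0)).congr_deriv ?_
      simp only [hv, id, Pi.pow_apply]
      field_simp
      ring
    have hc : ContinuousOn (fun s => f' s ^ 2 - f s ^ 2 / (4 * s ^ 2)) (Icc e m) := by
      refine ContinuousOn.sub (by fun_prop) (ContinuousOn.div (by fun_prop) (by fun_prop) ?_)
      intro s hs; have := hne s hs; positivity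
    have := intervalIntegral.integral_eq_sub_of_hasDerivAt hd
      (hi hee (hc.sub (hvc.pow 2)))
    rw [intervalIntegral.integral_sub (hi hee hc) (hi hee (by fun_prop)), hfe] at this
    simp only [ne_eq, OfNat.ofNat_ne_zero, not_false_eq_true, zero_pow, zero_div, sub_zero] at this
    linarith
  set V := ∫ s in e..m, v s ^ 2 with hV
  set B := ∫ s in e..m, (Q s) ^ 2 with hB
  set X := ∫ s in e..m, |f s| ^ 2 with hX
  have hV0 : 0 ≤ V := intervalIntegral.integral_nonneg hem fun _ _ => sq_nonneg _
  have hB0 : 0 ≤ B := intervalIntegral.integral_nonneg hem fun _ _ => sq_nonneg _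
  have hX0 : 0 ≤ X := intervalIntegral.integral_nonneg hem fun _ _ => sq_nonneg _
  have hfm0 : 0 ≤ f m ^ 2 / (2 * m) := by positivity
  rw [hA]
  set A := V + f m ^ 2 / (2 * m) with hAdef
  have hA0 : 0 ≤ A := by positivity
  refine ⟨hA0, ?_⟩
  -- the Poincaré inequality
  have hXA : X ≤ 2 * m ^ 2 * A := by
    have hd : ∀ s ∈ uIcc e m, HasDerivAt (fun s => s * f s ^ 2)
        (2 * |f s| ^ 2 + 2 * s * f s * v s) s := by
      intro s hs
      rw [uIcc_of_le hem] at hs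
      have h0 := hne s hs
      refine ((hasDerivAt_id s).mul ((hf s).pow 2)).congr_deriv ?_
      simp only [hv, id, sq_abs, Pi.pow_apply]
      field_simp
      ring
    have h1 := intervalIntegral.integral_eq_sub_of_hasDerivAt hd
      (hi hee (ContinuousOn.add (by fun_prop) (ContinuousOn.mul (by fun_prop) hvc)))
    rw [hfe] at h1
    have h2 : ∫ s in e..m, (|f s| ^ 2 - m ^ 2 * v s ^ 2) ≤
        ∫ s in e..m, (2 * |f s| ^ 2 + 2 * s * f s * v s) := by
      refine intervalIntegral.integral_mono_on hem (hi hee (by fun_prop)) (hi hee (by fun_prop)) ?_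
      intro s hs
      have : s ^ 2 * v s ^ 2 ≤ m ^ 2 * v s ^ 2 := by
        have := he.trans_le hs.1
        have := hs.2
        gcongr
      rw [sq_abs]
      nlinarith [sq_nonneg (f s + s * v s)]
    rw [h1, intervalIntegral.integral_sub (hi hee (by fun_prop)) (hi hee (by fun_prop)),
      intervalIntegral.integral_const_mul] at h2
    have h3 : 2 * m ^ 2 * A = 2 * m ^ 2 * V + m * f m ^ 2 := by
      rw [hAdef]; field_simp
    nlinarith [mul_nonneg (sq_nonneg m) hV0]
  have hdp : ∀ s ∈ Icc e m, HasDerivAt P (p / 2 * P s / s + p * (S s * f s) * v s) s := by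
    intro s hs
    have h0 := hne s hs
    have h1 : HasDerivAt P (p * |f s| ^ (p - 2) * f s * f' s) s := by
      rw [funext hP]
      exact (hasDerivAt_abs_rpow (f s) (by linarith : 1 < p)).comp s (hf s)
    refine h1.congr_deriv ?_
    rw [← hS, hPQ, hQS, mul_assoc (S s), abs_mul_abs_self]
    simp only [hv]
    field_simp
    ring
  have habs : ∀ s, |(S s * f s)| = Q s := by
    intro s
    rw [abs_mul, abs_of_nonneg (hS0 s), hQS]
  have hQv : ∀ s, 0 ≤ Q s * |v s| := fun s => mul_nonneg (hQ0 s) (abs_nonneg _)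
  have hVA : V ≤ A := by linarith
  set R := √(A * B) with hR
  have hcs1 : ∫ s in e..m, Q s * |v s| ≤ R := by
    refine Real.le_sqrt_of_sq_le
      ((sq_intervalIntegral_mul_le hem hQc.continuousOn hvc.abs).trans ?_)
    simp only [sq_abs]
    rw [mul_comm]
    gcongr
  have hcs2 : ∫ s in e..m, P s ≤ 2 * m * R := by
    simp only [hPQ]
    rw [← abs_of_nonneg (by positivity : 0 ≤ 2 * m * R)]
    refine (abs_le_of_sq_le_sq' (b := |2 * m * R|) ?_ (abs_nonneg _)).2
    refine ((sq_intervalIntegral_mul_le hem hQc.continuousOn hfc.abs.continuousOn).trans ?_)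
    rw [sq_abs, mul_pow, hR, Real.sq_sqrt (by positivity)]
    calc B * X ≤ B * (2 * m ^ 2 * A) := by gcongr
      _ ≤ (2 * m) ^ 2 * (A * B) := by nlinarith [mul_nonneg (mul_nonneg hA0 hB0) (sq_nonneg m)]
  have hR0 : 0 ≤ R := Real.sqrt_nonneg _
  -- the midpoint
  have hmid : P m ≤ (2 + 2 * p) * R := by
    have hd : ∀ s ∈ uIcc e m, HasDerivAt (fun s => s * P s)
        ((1 + p / 2) * P s + s * p * (S s * f s) * v s) s := by
      intro s hs
      rw [uIcc_of_le hem] at hs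
      have h0 := hne s hs
      refine ((hasDerivAt_id s).mul (hdp s hs)).congr_deriv ?_
      simp only [id]
      field_simp
      ring
    have h1 := intervalIntegral.integral_eq_sub_of_hasDerivAt hd
      (hi hee (by fun_prop))
    have h2 : ∫ s in e..m, ((1 + p / 2) * P s + s * p * (S s * f s) * v s) ≤
        ∫ s in e..m, ((1 + p / 2) * P s + m * p * (Q s * |v s|)) := by
      refine intervalIntegral.integral_mono_on hem (hi hee (by fun_prop)) (hi hee (by fun_prop)) ?_
      intro s hs
      have h3 : s * p * (S s * f s) * v s ≤ s * p * (Q s * |v s|) := by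
        rw [mul_assoc, ← habs s, ← abs_mul]
        have := he.trans_le hs.1
        exact mul_le_mul_of_nonneg_left (le_abs_self _) (by positivity)
      have h4 : s * p * (Q s * |v s|) ≤ m * p * (Q s * |v s|) := by
        have := hs.2
        have := hQv s
        gcongr
      linarith
    rw [h1, intervalIntegral.integral_add (hi hee (by fun_prop)) (hi hee (by fun_prop)),
      intervalIntegral.integral_const_mul, intervalIntegral.integral_const_mul, hP e, hfe, abs_zero,
      Real.zero_rpow (by linarith)] at h2
    have h5 : m * P m ≤ m * ((2 + 2 * p) * R) := by
      calc m * P m = m * P m - e * 0 := by ring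
        _ ≤ _ := h2
        _ ≤ (1 + p / 2) * (2 * m * R) + m * p * R := by gcongr
        _ = _ := by ring
    exact le_of_mul_le_mul_left h5 hm
  intro t ht
  have ht0 : 0 < t := he.trans_le ht.1
  have hfin : P t ≤ (2 + 3 * p) * R := by
    have hrc : ContinuousOn (fun s : ℝ => s ^ (-(p / 2))) (Icc e m) :=
      continuousOn_id.rpow_const fun s hs => Or.inl (hne s hs)
    have hd : ∀ s ∈ uIcc t m, HasDerivAt (fun s => s ^ (-(p / 2)) * P s)
        (s ^ (-(p / 2)) * (p * (S s * f s) * v s)) s := by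
      intro s hs
      rw [uIcc_of_le ht.2] at hs
      have hs' : s ∈ Icc e m := ⟨ht.1.trans hs.1, hs.2⟩
      have h0 := hne s hs'
      refine ((Real.hasDerivAt_rpow_const (p := -(p / 2)) (Or.inl h0)).mul
        (hdp s hs')).congr_deriv ?_
      rw [Real.rpow_sub_one h0]
      field_simp
      ring
    have h1 := intervalIntegral.integral_eq_sub_of_hasDerivAt hd
      (hi ht (by fun_prop))
    have h2 : ∫ s in t..m, -(t ^ (-(p / 2)) * p * (Q s * |v s|)) ≤
        ∫ s in t..m, (s ^ (-(p / 2)) * (p * (S s * f s) * v s)) := by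
      refine intervalIntegral.integral_mono_on ht.2 (hi ht (by fun_prop)) (hi ht (by fun_prop)) ?_
      intro s hs
      have h3 : s ^ (-(p / 2)) ≤ t ^ (-(p / 2)) :=
        Real.rpow_le_rpow_of_nonpos ht0 hs.1 (by linarith)
      have hs0 : 0 < s := ht0.trans_le hs.1
      rw [neg_le]
      calc -(s ^ (-(p / 2)) * (p * (S s * f s) * v s))
          = s ^ (-(p / 2)) * p * -(S s * f s * v s) := by ring
        _ ≤ s ^ (-(p / 2)) * p * (Q s * |v s|) := by
            rw [← habs s, ← abs_mul]
            exact mul_le_mul_of_nonneg_left (neg_le_abs _) (by positivity)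
        _ ≤ _ := by
            have := hQv s
            gcongr
    rw [h1, intervalIntegral.integral_neg, intervalIntegral.integral_const_mul] at h2
    have h4 : ∫ s in t..m, Q s * |v s| ≤ R := by
      refine le_trans ?_ hcs1
      refine intervalIntegral.integral_mono_interval ht.1 ht.2 le_rfl ?_ (hi hee (by fun_prop))
      exact Filter.Eventually.of_forall fun s => hQv s
    have h5 : m ^ (-(p / 2)) ≤ t ^ (-(p / 2)) :=
      Real.rpow_le_rpow_of_nonpos ht0 ht.2 (by linarith)
    have hPm := hP0 m
    have h6 : t ^ (-(p / 2)) * P t ≤ t ^ (-(p / 2)) * ((2 + 3 * p) * R) := by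
      calc t ^ (-(p / 2)) * P t
          ≤ m ^ (-(p / 2)) * P m +
            t ^ (-(p / 2)) * p * ∫ s in t..m, Q s * |v s| := by linarith
        _ ≤ t ^ (-(p / 2)) * ((2 + 2 * p) * R) + t ^ (-(p / 2)) * p * R := by gcongr
        _ = _ := by ring
    exact le_of_mul_le_mul_left h6 (by positivity)
  have hPt := hP0 t
  calc (P t) ^ 2 ≤ ((2 + 3 * p) * R) ^ 2 := by gcongr
    _ = _ := by rw [mul_pow, hR, Real.sq_sqrt (by positivity)]

/-- `hardy_remainder_Icc` in terms of lower Lebesgue integrals, for functions vanishing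
below `e`. -/
lemma hardy_remainder_Iic {f f' : ℝ → ℝ} {e m p : ℝ} (he : 0 < e) (hem : e ≤ m) (hp : 2 ≤ p)
    (hf : ∀ s, HasDerivAt f (f' s) s) (hf' : Continuous f') (h0 : ∀ s ≤ e, f s = 0)
    {w : ℝ → ℝ≥0∞} (hw : ∀ s ∈ Ioc e m, w s ≤ ENNReal.ofReal (1 / (4 * s ^ 2))) :
    ∫⁻ s in Iic m, ‖f s‖ₑ ^ 2 * w s ≠ ⊤ ∧
    ∫⁻ s in Iic m, ‖f s‖ₑ ^ 2 * w s ≤ ∫⁻ s in Iic m, ‖f' s‖ₑ ^ 2 ∧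
    ∀ t ≤ m, (‖f t‖ₑ ^ p) ^ 2 ≤ ENNReal.ofReal ((2 + 3 * p) ^ 2) *
      (((∫⁻ s in Iic m, ‖f' s‖ₑ ^ 2) - (∫⁻ s in Iic m, ‖f s‖ₑ ^ 2 * w s)) *
        (∫⁻ s in Iic m, (‖f s‖ₑ ^ (p - 1)) ^ 2)) := by
  obtain ⟨hA, hB⟩ := hardy_remainder_Icc he hem hp hf hf' (h0 e le_rfl)
  have hfc : Continuous f := continuous_iff_continuousAt.2 fun s => (hf s).continuousAt
  have hi : ∀ {z : ℝ → ℝ}, ContinuousOn z (Icc e m) → IntervalIntegrable z volume e m :=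
    fun hz => ContinuousOn.intervalIntegrable (by rwa [uIcc_of_le hem])
  have hl : ∀ {z : ℝ → ℝ}, ContinuousOn z (Icc e m) → (∀ s, 0 ≤ z s) →
      ENNReal.ofReal (∫ s in e..m, z s) = ∫⁻ s in Ioc e m, ENNReal.ofReal (z s) := by
    intro z hz hz0
    rw [intervalIntegral.integral_of_le hem,
      ofReal_integral_eq_lintegral_ofReal ((intervalIntegrable_iff_integrableOn_Ioc_of_le hem).1
        (hi hz)) (Filter.Eventually.of_forall hz0)]
  have hsub : Ioc e m ⊆ Iic m := fun s hs => hs.2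
  have hwc : ContinuousOn (fun s => f s ^ 2 / (4 * s ^ 2)) (Icc e m) := by
    refine ContinuousOn.div (by fun_prop) (by fun_prop) ?_
    intro s hs; have := he.trans_le hs.1; positivity
  have hqc : Continuous fun s => (|f s| ^ (p - 1)) ^ 2 :=
    (hfc.abs.rpow_const fun s => Or.inr (by linarith)).pow 2
  have hα : ENNReal.ofReal (∫ s in e..m, f' s ^ 2) ≤ ∫⁻ s in Iic m, ‖f' s‖ₑ ^ 2 := by
    rw [hl (by fun_prop) fun _ => sq_nonneg _]
    refine (lintegral_mono fun s => ?_).trans (lintegral_mono_set hsub)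
    rw [Real.enorm_eq_ofReal_abs, ← ENNReal.ofReal_pow (abs_nonneg _), sq_abs]
  have hβ : ∫⁻ s in Iic m, ‖f s‖ₑ ^ 2 * w s ≤
      ENNReal.ofReal (∫ s in e..m, f s ^ 2 / (4 * s ^ 2)) := by
    rw [hl hwc fun _ => by positivity]
    rw [← Iic_union_Ioc_eq_Iic hem, lintegral_union measurableSet_Ioc
      (Iic_disjoint_Ioc le_rfl), setLIntegral_congr_fun (g := 0) measurableSet_Iic
      (fun s hs => by simp [h0 s hs])]
    simp only [Pi.zero_apply, lintegral_zero, zero_add]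
    refine setLIntegral_mono' measurableSet_Ioc fun s hs => ?_
    rw [div_eq_mul_one_div, ENNReal.ofReal_mul (sq_nonneg _), Real.enorm_eq_ofReal_abs,
      ← ENNReal.ofReal_pow (abs_nonneg _), sq_abs]
    gcongr
    exact hw s hs
  have hγ : ENNReal.ofReal (∫ s in e..m, (|f s| ^ (p - 1)) ^ 2) ≤
      ∫⁻ s in Iic m, (‖f s‖ₑ ^ (p - 1)) ^ 2 := by
    rw [hl hqc.continuousOn fun _ => sq_nonneg _]
    refine (lintegral_mono fun s => ?_).trans (lintegral_mono_set hsub)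
    rw [Real.enorm_eq_ofReal_abs, ENNReal.ofReal_pow (by positivity),
      ENNReal.ofReal_rpow_of_nonneg (abs_nonneg _) (by linarith)]
  rw [intervalIntegral.integral_sub (hi (by fun_prop)) (hi hwc)] at hA hB
  refine ⟨ne_top_of_le_ne_top ENNReal.ofReal_ne_top hβ, hβ.trans (le_trans ?_ hα), ?_⟩
  · exact ENNReal.ofReal_le_ofReal (by linarith)
  · intro t ht
    rcases le_total t e with hte | hte
    · rw [h0 t hte, enorm_zero, ENNReal.zero_rpow_of_pos (by linarith)]
      simp
    · have := ENNReal.ofReal_le_ofReal (hB t ⟨hte, ht⟩)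
      rw [ENNReal.ofReal_mul (by positivity), ENNReal.ofReal_mul hA, ENNReal.ofReal_sub _
        (intervalIntegral.integral_nonneg hem fun _ _ => by positivity),
        ENNReal.ofReal_pow (by positivity)] at this
      rw [Real.enorm_eq_ofReal_abs, ENNReal.ofReal_rpow_of_nonneg (abs_nonneg _) (by linarith)]
      refine this.trans ?_
      gcongr

/-- The one-dimensional sharp Hardy inequality with weight `1 / (4 dist(·, Sᶜ)²)` on an interval
`S`, with a Gagliardo–Nirenberg remainder. -/
lemma hardy_remainder_line {f f' : ℝ → ℝ} {p : ℝ} (hp : 2 ≤ p)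
    (hf : ∀ s, HasDerivAt f (f' s) s) (hf' : Continuous f') (hcs : HasCompactSupport f)
    {S : Set ℝ} (hSo : IsOpen S) (hSc : Convex ℝ S) (hfS : tsupport f ⊆ S) :
    ∫⁻ s, ‖f s‖ₑ ^ 2 * (4⁻¹ * (infEDist s Sᶜ)⁻¹ ^ 2) ≤ ∫⁻ s, ‖f' s‖ₑ ^ 2 ∧
    ∀ t, (‖f t‖ₑ ^ p) ^ 2 ≤ ENNReal.ofReal ((2 + 3 * p) ^ 2) *
      (((∫⁻ s, ‖f' s‖ₑ ^ 2) - (∫⁻ s, ‖f s‖ₑ ^ 2 * (4⁻¹ * (infEDist s Sᶜ)⁻¹ ^ 2))) *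
        (∫⁻ s, (‖f s‖ₑ ^ (p - 1)) ^ 2)) := by
  rcases (tsupport f).eq_empty_or_nonempty with hemp | hne
  · rw [tsupport_eq_empty_iff] at hemp
    simp [hemp, ENNReal.zero_rpow_of_pos (by linarith : 0 < p)]
  obtain ⟨a', ha', hamin⟩ := IsCompact.exists_isLeast hcs hne
  obtain ⟨b', hb', hbmax⟩ := IsCompact.exists_isGreatest hcs hne
  obtain ⟨δ₁, hδ₁, hball₁⟩ := Metric.isOpen_iff.1 hSo a' (hfS ha')
  obtain ⟨δ₂, hδ₂, hball₂⟩ := Metric.isOpen_iff.1 hSo b' (hfS hb')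
  obtain ⟨e, he, he₁, he₂⟩ : ∃ e > 0, 2 * e < δ₁ ∧ 2 * e < δ₂ :=
    ⟨min δ₁ δ₂ / 4, by positivity, by linarith [min_le_left δ₁ δ₂, lt_min hδ₁ hδ₂],
      by linarith [min_le_right δ₁ δ₂, lt_min hδ₁ hδ₂]⟩
  set a := a' - 2 * e with ha
  set b := b' + 2 * e with hb
  have hab' : a' ≤ b' := hamin hb'
  have hIcc : Icc a b ⊆ S := hSc.ordConnected.out
    (hball₁ (by simp [ha, abs_of_pos he, he₁]))
    (hball₂ (by simp [hb, abs_of_pos he, he₂]))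
  set m := (b - a) / 2 with hm
  set c := (a + b) / 2 with hc
  have hem : e ≤ m := by linarith
  have hedist : ∀ t s : ℝ, 0 < s → s ≤ m → (t = a + s ∨ t = b - s) →
      4⁻¹ * (infEDist t Sᶜ)⁻¹ ^ 2 ≤ ENNReal.ofReal (1 / (4 * s ^ 2)) := by
    intro t s hs hsm hts
    have h1 : ENNReal.ofReal s ≤ infEDist t Sᶜ := by
      refine le_infEDist.2 fun y hy => ?_
      have hy' : y ∉ Icc a b := fun h => hy (hIcc h)
      rw [edist_dist]
      refine ENNReal.ofReal_le_ofReal ?_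
      rw [Real.dist_eq, le_abs]
      rw [mem_Icc, not_and_or, not_le, not_le] at hy'
      rcases hts with rfl | rfl <;> rcases hy' with h | h
      · left; linarith
      · right; linarith
      · left; linarith
      · right; linarith
    have h2 : (infEDist t Sᶜ)⁻¹ ≤ ENNReal.ofReal s⁻¹ := by
      rw [ENNReal.ofReal_inv_of_pos hs]
      exact ENNReal.inv_le_inv.2 h1
    calc 4⁻¹ * (infEDist t Sᶜ)⁻¹ ^ 2 ≤ 4⁻¹ * ENNReal.ofReal s⁻¹ ^ 2 := by gcongr
      _ = ENNReal.ofReal (1 / (4 * s ^ 2)) := by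
        rw [← ENNReal.ofReal_pow (by positivity),
          show (4⁻¹ : ℝ≥0∞) = ENNReal.ofReal 4⁻¹ by
            rw [ENNReal.ofReal_inv_of_pos (by norm_num)]; norm_num,
          ← ENNReal.ofReal_mul (by norm_num)]
        congr 1
        field_simp
  have hzero : ∀ t, t < a' ∨ b' < t → f t = 0 := by
    intro t ht
    by_contra h
    have := subset_tsupport f h
    rcases ht with ht | ht
    · linarith [hamin this]
    · linarith [hbmax this]
  set h : ℝ → ℝ≥0∞ := fun s => 4⁻¹ * (infEDist s Sᶜ)⁻¹ ^ 2 with hh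
  obtain ⟨hL0, hL1, hL2⟩ := hardy_remainder_Iic (f := fun s => f (a + s))
    (f' := fun s => f' (a + s)) (w := fun s => h (a + s)) he hem hp
    (fun s => (hf (a + s)).comp_const_add a s) (by fun_prop)
    (fun s hs => hzero _ (Or.inl (by linarith)))
    (fun s hs => hedist _ s (he.trans hs.1) hs.2 (Or.inl rfl))
  obtain ⟨hR0, hR1, hR2⟩ := hardy_remainder_Iic (f := fun s => f (b - s))
    (f' := fun s => -f' (b - s)) (w := fun s => h (b - s)) he hem hp
    (fun s => (hf (b - s)).comp_const_sub b s) (by fun_prop)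
    (fun s hs => hzero _ (Or.inr (by linarith)))
    (fun s hs => hedist _ s (he.trans hs.1) hs.2 (Or.inr rfl))
  have eL : ∀ g : ℝ → ℝ≥0∞, ∫⁻ s in Iic m, g (a + s) = ∫⁻ t in Iic c, g t := by
    intro g
    rw [← (measurePreserving_add_left volume a).setLIntegral_comp_preimage_emb
      (measurableEmbedding_addLeft a) g (Iic c)]
    congr 2
    ext s
    simp only [mem_preimage, mem_Iic, hm, hc]
    constructor <;> intro <;> linarith
  have eR : ∀ g : ℝ → ℝ≥0∞, ∫⁻ s in Iic m, g (b - s) = ∫⁻ t in (Iic c)ᶜ, g t := by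
    intro g
    rw [compl_Iic, setLIntegral_congr Ioi_ae_eq_Ici,
      ← (Measure.measurePreserving_sub_left volume b).setLIntegral_comp_preimage_emb
      (MeasurableEquiv.subLeft b).measurableEmbedding g (Ici c)]
    congr 2
    ext s
    simp only [mem_preimage, mem_Ici, mem_Iic, hm, hc]
    constructor <;> intro <;> linarith
  simp only [enorm_neg] at hR1 hR2
  rw [eL (fun t => ‖f t‖ₑ ^ 2 * h t)] at hL0
  rw [eL (fun t => ‖f t‖ₑ ^ 2 * h t), eL (fun t => ‖f' t‖ₑ ^ 2)] at hL1 hL2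
  rw [eL (fun t => (‖f t‖ₑ ^ (p - 1)) ^ 2)] at hL2
  rw [eR (fun t => ‖f t‖ₑ ^ 2 * h t)] at hR0
  rw [eR (fun t => ‖f t‖ₑ ^ 2 * h t), eR (fun t => ‖f' t‖ₑ ^ 2)] at hR1 hR2
  rw [eR (fun t => (‖f t‖ₑ ^ (p - 1)) ^ 2)] at hR2
  rw [← lintegral_add_compl (fun t => ‖f t‖ₑ ^ 2 * h t) (measurableSet_Iic (a := c)),
    ← lintegral_add_compl (fun t => ‖f' t‖ₑ ^ 2) (measurableSet_Iic (a := c)),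
    ← lintegral_add_compl (fun t => (‖f t‖ₑ ^ (p - 1)) ^ 2) (measurableSet_Iic (a := c))]
  refine ⟨add_le_add hL1 hR1, fun t => ?_⟩
  have hsub : ∀ {x y z w : ℝ≥0∞}, y ≠ ⊤ → w ≠ ⊤ → y ≤ x → w ≤ z →
      x - y ≤ x + z - (y + w) := by
    intro x y z w hy hw hyx hwz
    refine ENNReal.le_sub_of_add_le_left (ENNReal.add_ne_top.2 ⟨hy, hw⟩) ?_
    calc y + w + (x - y) = (y + (x - y)) + w := by ring
      _ = x + w := by rw [add_tsub_cancel_of_le hyx]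
      _ ≤ x + z := by gcongr
  rcases le_total t c with htc | htc
  · have := hL2 (t - a) (by linarith)
    rw [show a + (t - a) = t by ring] at this
    refine this.trans ?_
    exact mul_le_mul_right (mul_le_mul' (hsub hL0 hR0 hL1 hR1) le_self_add) _
  · have := hR2 (b - t) (by linarith)
    rw [show b - (b - t) = t by ring] at this
    refine this.trans ?_
    refine mul_le_mul_right (mul_le_mul' ((hsub hR0 hL0 hR1 hL1).trans_eq ?_) le_add_self) _
    rw [add_comm, add_comm (∫⁻ t in (Iic c)ᶜ, ‖f t‖ₑ ^ 2 * h t)]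
section Gagliardo

open Function ENNReal

variable {ι : Type*} [DecidableEq ι]

/-- The lower Lebesgue integral over a line parallel to the `i`-th axis. -/
noncomputable def lineInt (i : ι) (g : (ι → ℝ) → ℝ≥0∞) (x : ι → ℝ) : ℝ≥0∞ :=
  ∫⁻ t, g (update x i t)

lemma lineInt_update (i : ι) (g : (ι → ℝ) → ℝ≥0∞) (x : ι → ℝ) (t : ℝ) :
    lineInt i g (update x i t) = lineInt i g x := by
  simp [lineInt]

lemma measurable_lineInt (i : ι) {g : (ι → ℝ) → ℝ≥0∞} (hg : Measurable g) :
    Measurable (lineInt i g) := by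
  have := hg.lmarginal (s := {i}) (fun _ : ι => (volume : Measure ℝ))
  rwa [lmarginal_singleton] at this

variable [Fintype ι]

lemma lintegral_mono_lineInt (i : ι) {g h : (ι → ℝ) → ℝ≥0∞} (hg : Measurable g)
    (hh : Measurable h) (hgh : ∀ x, lineInt i g x ≤ lineInt i h x) : ∫⁻ x, g x ≤ ∫⁻ x, h x := by
  rw [volume_pi]
  refine lintegral_le_of_lmarginal_le {i} hg hh ?_
  rw [lmarginal_singleton, lmarginal_singleton]
  exact hgh

/-- The square root of `(∫ a - ∫ b) * ∫ Q`, with integrals along lines parallel to the `i`-th axis,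
is bounded by the integral along these lines of a function with controlled full integral. -/
lemma exists_density (i : ι) {a b Q : (ι → ℝ) → ℝ≥0∞} (ha : Measurable a)
    (hb : Measurable b) (hQ : Measurable Q)
    (hba : ∀ x, lineInt i b x ≤ lineInt i a x) (ha' : ∫⁻ x, a x ≠ ⊤)
    (hQl : ∀ x, lineInt i Q x ≠ ⊤) :
    ∃ F : (ι → ℝ) → ℝ≥0∞, Measurable F ∧
      (∀ x, ((lineInt i a x - lineInt i b x) * lineInt i Q x) ^ (1 / 2 : ℝ) ≤ lineInt i F x) ∧
      ∫⁻ x, F x ≤ (((∫⁻ x, a x) - ∫⁻ x, b x) * ∫⁻ x, Q x) ^ (1 / 2 : ℝ) := by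
  set A : (ι → ℝ) → ℝ≥0∞ := fun x => lineInt i a x - lineInt i b x with hA
  have hAm : Measurable A := (measurable_lineInt i ha).sub (measurable_lineInt i hb)
  have hBm : Measurable (lineInt i Q) := measurable_lineInt i hQ
  have hb' : ∫⁻ x, b x ≠ ⊤ := ne_top_of_le_ne_top ha' (lintegral_mono_lineInt i hb ha hba)
  have hA_up : ∀ x t, A (update x i t) = A x := fun x t => by simp only [hA, lineInt_update]
  have hE : ∫⁻ x, A x * (lineInt i Q x)⁻¹ * Q x ≤ (∫⁻ x, a x) - ∫⁻ x, b x := by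
    refine ENNReal.le_sub_of_add_le_left hb' ?_
    rw [← lintegral_add_left hb]
    refine lintegral_mono_lineInt i (hb.add ((hAm.mul hBm.inv).mul hQ)) ha fun x => ?_
    have : ∀ t, A (update x i t) * (lineInt i Q (update x i t))⁻¹ * Q (update x i t) =
        A x * (lineInt i Q x)⁻¹ * Q (update x i t) := fun t => by
      rw [hA_up, lineInt_update]
    change ∫⁻ t, (b (update x i t) + A (update x i t) * (lineInt i Q (update x i t))⁻¹ *
      Q (update x i t)) ≤ lineInt i a x
    simp only [this]
    rw [lintegral_add_left (f := fun t => b (update x i t)) (hb.comp (measurable_update x)),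
      lintegral_const_mul (f := fun t => Q (update x i t)) _ (hQ.comp (measurable_update x))]
    calc lineInt i b x + A x * (lineInt i Q x)⁻¹ * lineInt i Q x
        = lineInt i b x + A x * ((lineInt i Q x)⁻¹ * lineInt i Q x) := by rw [mul_assoc]
      _ ≤ lineInt i b x + A x * 1 := by gcongr; exact ENNReal.inv_mul_le_one _
      _ = lineInt i a x := by rw [mul_one]; exact add_tsub_cancel_of_le (hba x)
  refine ⟨fun x => (A x * (lineInt i Q x)⁻¹) ^ (1 / 2 : ℝ) * Q x,
    ((hAm.mul hBm.inv).pow_const _).mul hQ, fun x => ?_, ?_⟩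
  · have : ∀ t, (A (update x i t) * (lineInt i Q (update x i t))⁻¹) ^ (1 / 2 : ℝ) *
        Q (update x i t) = (A x * (lineInt i Q x)⁻¹) ^ (1 / 2 : ℝ) * Q (update x i t) := fun t => by
      rw [hA_up, lineInt_update]
    change _ ≤ ∫⁻ t, (A (update x i t) * (lineInt i Q (update x i t))⁻¹) ^ (1 / 2 : ℝ) *
        Q (update x i t)
    simp only [this]
    rw [lintegral_const_mul (f := fun t => Q (update x i t)) _ (hQ.comp (measurable_update x))]
    change (A x * lineInt i Q x) ^ (1 / 2 : ℝ) ≤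
      (A x * (lineInt i Q x)⁻¹) ^ (1 / 2 : ℝ) * lineInt i Q x
    rcases eq_or_ne (lineInt i Q x) 0 with h0 | h0
    · simp [h0]
    · have h1 : lineInt i Q x = (lineInt i Q x ^ (2 : ℝ)) ^ (1 / 2 : ℝ) := by
        rw [← ENNReal.rpow_mul]; norm_num
      nth_rewrite 3 [h1]
      rw [← ENNReal.mul_rpow_of_nonneg _ _ (by norm_num)]
      refine ENNReal.rpow_le_rpow (le_of_eq ?_) (by norm_num)
      rw [ENNReal.rpow_two, sq, mul_assoc, ← mul_assoc (lineInt i Q x)⁻¹,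
        ENNReal.inv_mul_cancel h0 (hQl x), one_mul]
  · have hH := ENNReal.lintegral_mul_le_Lp_mul_Lq volume Real.HolderConjugate.two_two
      (f := fun x => (A x * (lineInt i Q x)⁻¹ * Q x) ^ (1 / 2 : ℝ))
      (g := fun x => Q x ^ (1 / 2 : ℝ))
      (((hAm.mul hBm.inv).mul hQ).pow_const _).aemeasurable (hQ.pow_const _).aemeasurable
    have e1 : ∀ y : ℝ≥0∞, (y ^ (1 / 2 : ℝ)) ^ (2 : ℝ) = y := fun y => by
      rw [← ENNReal.rpow_mul]; norm_num
    simp only [e1] at hH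
    rw [← ENNReal.mul_rpow_of_nonneg _ _ (by norm_num)] at hH
    refine (lintegral_mono fun x => le_of_eq ?_).trans (hH.trans ?_)
    · have e2 : Q x = Q x ^ (1 / 2 : ℝ) * Q x ^ (1 / 2 : ℝ) := by
        rw [← ENNReal.mul_rpow_of_nonneg _ _ (by norm_num), ← sq, ← ENNReal.rpow_two,
          ← ENNReal.rpow_mul]
        norm_num
      rw [Pi.mul_apply, ENNReal.mul_rpow_of_nonneg _ (Q x) (by norm_num), mul_assoc, ← e2]
    · gcongr

/-- An anisotropic Gagliardo–Nirenberg argument: one-dimensional multiplicative inequalities along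
all lines parallel to the axes imply a Sobolev inequality. -/
lemma sobolev_of_lines {N : ℕ} (hN : 3 ≤ N) {p : ℝ} (hp : p * ((N : ℝ) - 2) = 2 * N - 2)
    {C : ℝ≥0∞} (hC : C ≠ ⊤) :
    ∃ K : ℝ≥0∞, K ≠ ⊤ ∧ ∀ (φ : (Fin N → ℝ) → ℝ≥0∞) (a b : Fin N → (Fin N → ℝ) → ℝ≥0∞),
      Measurable φ → (∀ i, Measurable (a i)) → (∀ i, Measurable (b i)) →
      (∀ i x, lineInt i (b i) x ≤ lineInt i (a i) x) →
      (∀ i, ∫⁻ x, a i x ≠ ⊤) →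
      (∫⁻ x, φ x ^ (2 * p - 2) ≠ ⊤) → (∀ i x, lineInt i (fun y => φ y ^ (2 * p - 2)) x ≠ ⊤) →
      (∀ i x, (φ x ^ p) ^ 2 ≤ C * ((lineInt i (a i) x - lineInt i (b i) x) *
        lineInt i (fun y => φ y ^ (2 * p - 2)) x)) →
      (∫⁻ x, φ x ^ (2 * p - 2)) ^ (((N : ℝ) - 2) / N) ≤
        K * ∑ i, ((∫⁻ x, a i x) - ∫⁻ x, b i x) := by
  have hN' : (3 : ℝ) ≤ N := by exact_mod_cast hN
  refine ⟨C * N ^ 2, ENNReal.mul_ne_top hC (by simp), ?_⟩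
  intro φ a b hφ ha hb hba ha' hQ' hQl hline
  set Q : (Fin N → ℝ) → ℝ≥0∞ := fun y => φ y ^ (2 * p - 2) with hQ
  have hQm : Measurable Q := hφ.pow_const _
  choose F hFm hFl hF using fun i =>
    exists_density i (ha i) (hb i) hQm (hba i) (ha' i) (hQl i)
  set E := ∑ i, ((∫⁻ x, a i x) - ∫⁻ x, b i x) with hE
  set q := ∫⁻ x, Q x with hq
  set G : (Fin N → ℝ) → ℝ≥0∞ := fun x => C ^ (1 / 2 : ℝ) * ∑ i, F i x with hG
  have hGm : Measurable G := (Finset.measurable_sum _ fun i _ => hFm i).const_mul _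
  have hGint : ∫⁻ x, G x ≤ (C * N ^ 2 * (E * q)) ^ (1 / 2 : ℝ) := by
    rw [hG, lintegral_const_mul _ (Finset.measurable_sum _ fun i _ => hFm i),
      lintegral_finsetSum _ fun i _ => hFm i]
    calc C ^ (1 / 2 : ℝ) * ∑ i, ∫⁻ x, F i x
        ≤ C ^ (1 / 2 : ℝ) * ∑ i : Fin N, (E * q) ^ (1 / 2 : ℝ) := by
          gcongr with i
          refine (hF i).trans ?_
          gcongr
          exact Finset.single_le_sum
            (f := fun i => (∫⁻ x, a i x) - ∫⁻ x, b i x) (fun _ _ => zero_le) (Finset.mem_univ i)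
      _ = (C * N ^ 2 * (E * q)) ^ (1 / 2 : ℝ) := by
          rw [Finset.sum_const, Finset.card_univ, Fintype.card_fin, nsmul_eq_mul,
            ENNReal.mul_rpow_of_nonneg (C * N ^ 2) (E * q) (by norm_num),
            ENNReal.mul_rpow_of_nonneg C _ (by norm_num), ← ENNReal.rpow_two (N : ℝ≥0∞),
            ← ENNReal.rpow_mul, mul_assoc]
          norm_num
  have hconj : Real.HolderConjugate (Fintype.card (Fin N)) ((N : ℝ) / (N - 1)) := by
    rw [Fintype.card_fin, Real.holderConjugate_iff]
    refine ⟨by linarith, ?_⟩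
    field_simp
    ring
  have hLW := lintegral_prod_lintegral_pow_le (fun _ : Fin N => (volume : Measure ℝ)) hconj hGm
  rw [Fintype.card_fin, ← volume_pi] at hLW
  have hpt : ∀ x, Q x ≤ ∏ i, (∫⁻ t, G (update x i t)) ^ ((1 : ℝ) / ((N : ℝ) - 1)) := by
    intro x
    have h1 : ∀ i, φ x ^ p ≤ ∫⁻ t, G (update x i t) := by
      intro i
      have h2 : ∫⁻ t, C ^ (1 / 2 : ℝ) * F i (update x i t) ≤ ∫⁻ t, G (update x i t) := by
        refine lintegral_mono fun t => mul_le_mul_right (Finset.single_le_sum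
          (f := fun j => F j (update x i t)) (fun _ _ => zero_le) (Finset.mem_univ i)) _
      refine le_trans ?_ h2
      rw [lintegral_const_mul (f := fun t => F i (update x i t)) _
        ((hFm i).comp (measurable_update x))]
      calc φ x ^ p = ((φ x ^ p) ^ 2) ^ (1 / 2 : ℝ) := by
            rw [← ENNReal.rpow_two, ← ENNReal.rpow_mul (φ x ^ p)]; norm_num
        _ ≤ _ := ENNReal.rpow_le_rpow (hline i x) (by norm_num)
        _ = C ^ (1 / 2 : ℝ) * _ := ENNReal.mul_rpow_of_nonneg _ _ (by norm_num)
        _ ≤ _ := by gcongr; exact hFl i x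
    calc Q x = ∏ i : Fin N, (φ x ^ p) ^ ((1 : ℝ) / ((N : ℝ) - 1)) := by
          rw [Finset.prod_const, Finset.card_univ, Fintype.card_fin, ← ENNReal.rpow_natCast,
            ← ENNReal.rpow_mul, ← ENNReal.rpow_mul]
          simp only [hQ]
          congr 1
          have h3 : (N : ℝ) - 1 ≠ 0 := by linarith
          have h4 : (N : ℝ) - 2 ≠ 0 := by linarith
          have h5 : p = (2 * N - 2) / (N - 2) := by rw [← hp]; field_simp
          rw [h5]
          field_simp
          ring
      _ ≤ _ := Finset.prod_le_prod' fun i _ => ENNReal.rpow_le_rpow (h1 i)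
          (one_div_nonneg.2 (by linarith))
  have hmain : q ≤ (C * N ^ 2 * E * q) ^ ((N : ℝ) / (2 * (N - 1))) := by
    calc q ≤ (∫⁻ x, G x) ^ ((N : ℝ) / (N - 1)) := (lintegral_mono hpt).trans hLW
      _ ≤ ((C * N ^ 2 * (E * q)) ^ (1 / 2 : ℝ)) ^ ((N : ℝ) / (N - 1)) :=
          ENNReal.rpow_le_rpow hGint (div_nonneg (by linarith) (by linarith))
      _ = _ := by
          rw [← ENNReal.rpow_mul, mul_assoc _ E q]
          congr 1
          field_simp
  rcases eq_or_ne q 0 with h0 | h0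
  · rw [h0, ENNReal.zero_rpow_of_pos (div_pos (by linarith) (by linarith))]
    exact zero_le
  · have h1 : q ^ (2 * ((N : ℝ) - 1) / N) ≤ C * N ^ 2 * E * q := by
      calc q ^ (2 * ((N : ℝ) - 1) / N)
          ≤ ((C * N ^ 2 * E * q) ^ ((N : ℝ) / (2 * (N - 1)))) ^ (2 * ((N : ℝ) - 1) / N) :=
            ENNReal.rpow_le_rpow hmain (div_nonneg (by linarith) (by linarith))
        _ = _ := by
            rw [← ENNReal.rpow_mul]
            have h3 : (N : ℝ) - 1 ≠ 0 := by linarith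
            have h4 : (N : ℝ) ≠ 0 := by linarith
            rw [show (N : ℝ) / (2 * (N - 1)) * (2 * (N - 1) / N) = 1 by field_simp,
              ENNReal.rpow_one]
    have h2 : q ^ (2 * ((N : ℝ) - 1) / N) = q ^ (((N : ℝ) - 2) / N) * q := by
      nth_rewrite 3 [← ENNReal.rpow_one q]
      rw [← ENNReal.rpow_add _ _ h0 hQ']
      congr 1
      have h4 : (N : ℝ) ≠ 0 := by linarith
      field_simp
      ring
    rw [h2] at h1
    exact (ENNReal.mul_le_mul_iff_left h0 hQ').1 h1

end Gagliardo

section Coordinates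

open Function WithLp

variable {N : ℕ} {Ω : Set (EuclideanSpace ℝ (Fin N))}

lemma toLp_update (y : Fin N → ℝ) (i : Fin N) (t : ℝ) :
    toLp 2 (update y i t) = toLp 2 y + (t - y i) • EuclideanSpace.basisFun (Fin N) ℝ i := by
  ext j
  rcases eq_or_ne j i with rfl | h
  · simp
  · simp [h]

/-- The distance to the complement of `Ω` along the `i`-th axis. -/
noncomputable def axisDist (Ω : Set (EuclideanSpace ℝ (Fin N))) (i : Fin N)
    (y : Fin N → ℝ) : ℝ≥0∞ :=
  infEDist (y i) {t | toLp 2 (update y i t) ∈ Ω}ᶜ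

lemma continuous_toLp_update (y : Fin N → ℝ) (i : Fin N) :
    Continuous fun t => (toLp 2 (update y i t) : EuclideanSpace ℝ (Fin N)) := by
  simp only [toLp_update]
  fun_prop

lemma isOpen_axis (hΩ : IsOpen Ω) (i : Fin N) (y : Fin N → ℝ) :
    IsOpen {t | toLp 2 (update y i t) ∈ Ω} :=
  hΩ.preimage (continuous_toLp_update y i)

lemma convex_axis (hΩ : Convex ℝ Ω) (i : Fin N) (y : Fin N → ℝ) :
    Convex ℝ {t | toLp 2 (update y i t) ∈ Ω} := by
  intro s hs t ht a b ha hb hab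
  have h := hΩ hs ht ha hb hab
  rw [mem_ofPred_eq]
  convert h using 1
  simp only [toLp_update, smul_eq_mul]
  rw [show b = 1 - a by linarith]
  module

lemma measurable_axisDist (hΩ : IsOpen Ω) (i : Fin N) : Measurable (axisDist Ω i) := by
  refine LowerSemicontinuous.measurable fun y r hr => ?_
  lift r to NNReal using ne_top_of_lt hr
  have hmem : ∀ s ∈ Icc (-(r : ℝ)) r, toLp 2 (update y i (y i + s)) ∈ Ω := by
    intro s hs
    by_contra hn
    have h1 : axisDist Ω i y ≤ edist (y i) (y i + s) := infEDist_le_edist_of_mem hn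
    have h2 : edist (y i) (y i + s) ≤ r := by
      rw [edist_dist, Real.dist_eq, ← ENNReal.ofReal_coe_nnreal]
      refine ENNReal.ofReal_le_ofReal ?_
      rw [abs_sub_comm, add_sub_cancel_left]
      exact abs_le.2 hs
    exact absurd hr (not_lt.2 (h1.trans h2))
  have hev : ∀ᶠ z in nhds y, ∀ s ∈ Icc (-(r : ℝ)) r, toLp 2 (update z i (z i + s)) ∈ Ω := by
    refine isCompact_Icc.eventually_forall_of_forall_eventually fun s hs => ?_
    have hc : Continuous fun w : (Fin N → ℝ) × ℝ =>
        (toLp 2 (update w.1 i (w.1 i + w.2)) : EuclideanSpace ℝ (Fin N)) := by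
      simp only [toLp_update]
      fun_prop
    exact (hΩ.preimage hc).mem_nhds (hmem s hs)
  filter_upwards [hev] with z hz
  by_contra! hle
  have hcl : IsClosed {t | toLp 2 (update z i t) ∈ Ω}ᶜ := (isOpen_axis hΩ i z).isClosed_compl
  have hne : ({t | toLp 2 (update z i t) ∈ Ω}ᶜ).Nonempty := by
    rw [nonempty_iff_ne_empty]
    intro h0
    rw [axisDist, h0, infEDist_empty] at hle
    exact absurd hle (by simp)
  obtain ⟨t, ht, hd⟩ := hcl.exists_infDist_eq_dist hne (z i)
  have h1 : dist (z i) t ≤ r := by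
    rw [← hd, infDist]
    exact ENNReal.toReal_le_coe_of_le_coe hle
  refine ht ?_
  have := hz (t - z i) (abs_le.1 (by rwa [Real.dist_eq, abs_sub_comm] at h1))
  rwa [add_sub_cancel] at this

/-- On convex sets the inverse square distance to the complement is bounded by the sum of the
inverse square distances along the axes. -/
lemma inv_infEDist_sq_le (hΩ : IsOpen Ω) (hc : Convex ℝ Ω) (hne : Ω ≠ univ)
    {y : Fin N → ℝ} (hy : toLp 2 y ∈ Ω) :
    ENNReal.ofReal ((infDist (toLp 2 y) Ωᶜ ^ 2)⁻¹) ≤ ∑ i, (axisDist Ω i y)⁻¹ ^ 2 := by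
  obtain ⟨z, hz, hd⟩ := hΩ.isClosed_compl.exists_infDist_eq_dist (nonempty_compl.2 hne) (toLp 2 y)
  obtain ⟨l, hl⟩ := geometric_hahn_banach_open_point hc hΩ hz
  set L := l (z - toLp 2 y) with hL
  have hLpos : 0 < L := by rw [hL, map_sub]; linarith [hl _ hy]
  have hLle : L ≤ ‖l‖ * infDist (toLp 2 y) Ωᶜ := by
    rw [hd, dist_comm, dist_eq_norm]
    exact (le_abs_self _).trans (l.le_opNorm _)
  have hdpos : 0 < infDist (toLp 2 y) Ωᶜ :=
    (infDist_nonneg).lt_of_ne' fun h => by rw [h, mul_zero] at hLle; linarith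
  have hi : ∀ i, ENNReal.ofReal (l (EuclideanSpace.basisFun (Fin N) ℝ i) ^ 2 / L ^ 2) ≤
      (axisDist Ω i y)⁻¹ ^ 2 := by
    intro i
    set c := l (EuclideanSpace.basisFun (Fin N) ℝ i) with hcdef
    rcases eq_or_ne c 0 with h0 | h0
    · simp [h0]
    have hmem : y i + L / c ∈ {t | toLp 2 (update y i t) ∈ Ω}ᶜ := by
      intro hm
      have := hl _ hm
      rw [toLp_update, map_add, map_smul, ← hcdef, smul_eq_mul, add_sub_cancel_left,
        div_mul_cancel₀ _ h0, hL, map_sub] at this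
      linarith
    have h1 : axisDist Ω i y ≤ ENNReal.ofReal |L / c| := by
      refine (infEDist_le_edist_of_mem hmem).trans (le_of_eq ?_)
      rw [edist_dist, Real.dist_eq, abs_sub_comm, add_sub_cancel_left]
    calc ENNReal.ofReal (c ^ 2 / L ^ 2) = (ENNReal.ofReal |L / c|)⁻¹ ^ 2 := by
          rw [← ENNReal.ofReal_inv_of_pos (abs_pos.2 (div_ne_zero hLpos.ne' h0)),
            ← ENNReal.ofReal_pow (by positivity), inv_pow, sq_abs, ← inv_pow, inv_div, div_pow]
      _ ≤ _ := by gcongr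
  refine le_trans ?_ (Finset.sum_le_sum fun i _ => hi i)
  rw [← ENNReal.ofReal_sum_of_nonneg fun i _ => by positivity]
  refine ENNReal.ofReal_le_ofReal ?_
  rw [← Finset.sum_div, ← OrthonormalBasis.norm_dual, inv_eq_one_div,
    div_le_div_iff₀ (by positivity) (by positivity), one_mul, ← mul_pow]
  gcongr

end Coordinates

section Assembly

open Function WithLp

lemma lintegral_enorm_rpow_ne_top {X : Type*} [TopologicalSpace X] [MeasurableSpace X]
    [OpensMeasurableSpace X] {μ : Measure X} [IsFiniteMeasureOnCompacts μ] {f : X → ℝ}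
    (hf : Continuous f) (hcs : HasCompactSupport f) {r : ℝ} (hr : 0 < r) :
    ∫⁻ x, ‖f x‖ₑ ^ r ∂μ ≠ ⊤ := by
  have h := lintegral_rpow_enorm_lt_top_of_eLpNorm_lt_top (p := ENNReal.ofReal r)
    (by simpa using hr) ENNReal.ofReal_ne_top
    (hf.memLp_of_hasCompactSupport (p := ENNReal.ofReal r) (μ := μ) hcs).2
  rw [ENNReal.toReal_ofReal hr.le] at h
  exact h.ne

lemma lintegral_toLp {N : ℕ} (g : EuclideanSpace ℝ (Fin N) → ℝ≥0∞) :
    ∫⁻ y, g (toLp 2 y) = ∫⁻ x, g x :=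
  (PiLp.volume_preserving_toLp (Fin N)).lintegral_comp_emb
    (MeasurableEquiv.toLp 2 (Fin N → ℝ)).measurableEmbedding g

lemma isClosedEmbedding_toLp_update {N : ℕ} (y : Fin N → ℝ) (i : Fin N) :
    Topology.IsClosedEmbedding fun t => (toLp 2 (update y i t) : EuclideanSpace ℝ (Fin N)) :=
  Function.LeftInverse.isClosedEmbedding (f := fun z : EuclideanSpace ℝ (Fin N) => z i)
    (fun t => by simp) (by fun_prop) (continuous_toLp_update y i)

lemma isClosedEmbedding_toLp {N : ℕ} :
    Topology.IsClosedEmbedding fun y : Fin N → ℝ => (toLp 2 y : EuclideanSpace ℝ (Fin N)) :=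
  (PiLp.homeomorph 2 fun _ : Fin N => ℝ).symm.isClosedEmbedding

/-- The Hardy–Sobolev–Maz'ya inequality in terms of lower Lebesgue integrals, together with
Hardy's inequality. -/
lemma hardy_sobolev_lintegral {N : ℕ} (hN : 3 ≤ N) : ∃ K : ℝ≥0∞, K ≠ ⊤ ∧
    ∀ (Ω : Set (EuclideanSpace ℝ (Fin N))), IsOpen Ω → Convex ℝ Ω → Ω ≠ univ →
      ∀ u : EuclideanSpace ℝ (Fin N) → ℝ, ContDiff ℝ 1 u → HasCompactSupport u → tsupport u ⊆ Ω →
        (∫⁻ x, ‖u x‖ₑ ^ 2 * (4⁻¹ * ENNReal.ofReal ((infDist x Ωᶜ ^ 2)⁻¹))) ≤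
          (∫⁻ x, ‖fderiv ℝ u x‖ₑ ^ 2) ∧
        (∫⁻ x, ‖u x‖ₑ ^ (2 * (N : ℝ) / (N - 2))) ^ (((N : ℝ) - 2) / N) ≤
          K * ((∫⁻ x, ‖fderiv ℝ u x‖ₑ ^ 2) -
            ∫⁻ x, ‖u x‖ₑ ^ 2 * (4⁻¹ * ENNReal.ofReal ((infDist x Ωᶜ ^ 2)⁻¹))) := by
  have hN' : (3 : ℝ) ≤ N := by exact_mod_cast hN
  set p : ℝ := (2 * N - 2) / (N - 2) with hpdef
  have hN2 : (N : ℝ) - 2 ≠ 0 := by linarith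
  have hp : p * ((N : ℝ) - 2) = 2 * N - 2 := div_mul_cancel₀ _ hN2
  have hp2 : 2 ≤ p := by rw [hpdef, le_div_iff₀ (by linarith)]; linarith
  have hq : 2 * (N : ℝ) / (N - 2) = 2 * p - 2 := by rw [hpdef]; field_simp; ring
  rw [hq]
  obtain ⟨K, hK, hmain⟩ := sobolev_of_lines hN hp (C := ENNReal.ofReal ((2 + 3 * p) ^ 2))
    ENNReal.ofReal_ne_top
  refine ⟨K, hK, fun Ω hΩ hΩc hΩne u hu hcs hsupp => ?_⟩
  set e := EuclideanSpace.basisFun (Fin N) ℝ with he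
  set φ : (Fin N → ℝ) → ℝ≥0∞ := fun y => ‖u (toLp 2 y)‖ₑ with hφ
  set a : Fin N → (Fin N → ℝ) → ℝ≥0∞ := fun i y => ‖fderiv ℝ u (toLp 2 y) (e i)‖ₑ ^ 2 with ha
  set b : Fin N → (Fin N → ℝ) → ℝ≥0∞ := fun i y => φ y ^ 2 * (4⁻¹ * (axisDist Ω i y)⁻¹ ^ 2)
    with hb
  have hdu : Continuous (fderiv ℝ u) := hu.continuous_fderiv one_ne_zero
  have hdui : ∀ i, Continuous fun x => fderiv ℝ u x (e i) := fun i => hdu.clm_apply continuous_const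
  have hduics : ∀ i, HasCompactSupport fun x => fderiv ℝ u x (e i) := fun i =>
    (hcs.fderiv ℝ).comp_left (g := fun l : StrongDual ℝ (EuclideanSpace ℝ (Fin N)) => l (e i)) rfl
  have hembed := isClosedEmbedding_toLp (N := N)
  have hφm : Measurable φ := (hu.continuous.comp hembed.continuous).enorm.measurable
  have ham : ∀ i, Measurable (a i) := fun i =>
    ((hdui i).comp hembed.continuous).enorm.measurable.pow_const 2
  have hbm : ∀ i, Measurable (b i) := fun i =>
    (hφm.pow_const 2).mul (((measurable_axisDist hΩ i).inv.pow_const 2).const_mul _)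
  have haint : ∀ i, ∫⁻ y, a i y ≠ ⊤ := fun i => by
    have := lintegral_enorm_rpow_ne_top (μ := volume) ((hdui i).comp hembed.continuous)
      ((hduics i).comp_isClosedEmbedding hembed) (r := 2) (by norm_num)
    simp only [ENNReal.rpow_two] at this
    exact this
  have hQ : ∫⁻ y, φ y ^ (2 * p - 2) ≠ ⊤ :=
    lintegral_enorm_rpow_ne_top (hu.continuous.comp hembed.continuous)
      (hcs.comp_isClosedEmbedding hembed) (by linarith)
  have hQl : ∀ i y, lineInt i (fun y => φ y ^ (2 * p - 2)) y ≠ ⊤ := fun i y =>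
    lintegral_enorm_rpow_ne_top (hu.continuous.comp (continuous_toLp_update y i))
      (hcs.comp_isClosedEmbedding (isClosedEmbedding_toLp_update y i)) (by linarith)
  have hderiv : ∀ (i : Fin N) (y : Fin N → ℝ) (s : ℝ), HasDerivAt
      (fun t => u (toLp 2 (update y i t))) (fderiv ℝ u (toLp 2 (update y i s)) (e i)) s := by
    intro i y s
    refine ((hu.differentiable one_ne_zero _).hasFDerivAt).comp_hasDerivAt s ?_
    simp only [toLp_update]
    have h := (((hasDerivAt_id s).sub_const (y i)).smul_const (e i)).const_add (toLp 2 y)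
    rwa [one_smul] at h
  have hline := fun (i : Fin N) (y : Fin N → ℝ) =>
    hardy_remainder_line hp2 (hderiv i y) ((hdui i).comp (continuous_toLp_update y i))
      (hcs.comp_isClosedEmbedding (isClosedEmbedding_toLp_update y i)) (isOpen_axis hΩ i y)
      (convex_axis hΩc i y)
      ((tsupport_comp_subset_preimage u (continuous_toLp_update y i)).trans
        (preimage_mono hsupp))
  have haxis : ∀ i y t, axisDist Ω i (update y i t) =
      infEDist t {t | toLp 2 (update y i t) ∈ Ω}ᶜ := fun i y t => by simp [axisDist]
  have hbl : ∀ i y, lineInt i (b i) y = ∫⁻ t, ‖u (toLp 2 (update y i t))‖ₑ ^ 2 *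
      (4⁻¹ * (infEDist t {t | toLp 2 (update y i t) ∈ Ω}ᶜ)⁻¹ ^ 2) := fun i y => by
    simp only [lineInt, hb, haxis, hφ]
  have hba : ∀ i y, lineInt i (b i) y ≤ lineInt i (a i) y := fun i y => by
    rw [hbl]
    exact (hline i y).1
  have hsob := hmain φ a b hφm ham hbm hba haint hQ hQl fun i y => by
    have h := (hline i y).2 (y i)
    have h2 : ∀ z : ℝ≥0∞, (z ^ (p - 1)) ^ 2 = z ^ (2 * p - 2) := fun z => by
      rw [← ENNReal.rpow_two, ← ENNReal.rpow_mul]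
      congr 1
      ring
    simp only [h2, update_eq_self] at h
    rw [hbl]
    exact h
  have hbaint : ∀ i, ∫⁻ y, b i y ≤ ∫⁻ y, a i y := fun i =>
    lintegral_mono_lineInt i (hbm i) (ham i) (hba i)
  have hgrad : ∑ i, ∫⁻ y, a i y = ∫⁻ x, ‖fderiv ℝ u x‖ₑ ^ 2 := by
    rw [← lintegral_finsetSum _ fun i _ => ham i, ← lintegral_toLp]
    refine lintegral_congr fun y => ?_
    simp only [ha, Real.enorm_eq_ofReal_abs]
    rw [← ofReal_norm, ← ENNReal.ofReal_pow (norm_nonneg _), OrthonormalBasis.norm_dual e,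
      ENNReal.ofReal_sum_of_nonneg fun i _ => sq_nonneg _]
    refine Finset.sum_congr rfl fun i _ => ?_
    rw [← ENNReal.ofReal_pow (abs_nonneg _), sq_abs]
  have hhardy : (∫⁻ x, ‖u x‖ₑ ^ 2 * (4⁻¹ * ENNReal.ofReal ((infDist x Ωᶜ ^ 2)⁻¹))) ≤
      ∑ i, ∫⁻ y, b i y := by
    rw [← lintegral_finsetSum _ fun i _ => hbm i, ← lintegral_toLp]
    refine lintegral_mono fun y => ?_
    by_cases hy : toLp 2 y ∈ Ω
    · simp only [hb]
      rw [← Finset.mul_sum, ← Finset.mul_sum]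
      gcongr
      exact inv_infEDist_sq_le hΩ hΩc hΩne hy
    · have : u (toLp 2 y) = 0 := image_eq_zero_of_notMem_tsupport fun h => hy (hsupp h)
      simp [this]
  have hle : ∑ i, ∫⁻ y, b i y ≤ ∑ i, ∫⁻ y, a i y := Finset.sum_le_sum fun i _ => hbaint i
  have hsum : ∑ i, ((∫⁻ y, a i y) - ∫⁻ y, b i y) = (∑ i, ∫⁻ y, a i y) - ∑ i, ∫⁻ y, b i y := by
    refine ENNReal.eq_sub_of_add_eq
      (ne_top_of_le_ne_top (ENNReal.sum_ne_top.2 fun i _ => haint i) hle) ?_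
    rw [← Finset.sum_add_distrib]
    exact Finset.sum_congr rfl fun i _ => tsub_add_cancel_of_le (hbaint i)
  refine ⟨hhardy.trans (hle.trans hgrad.le), ?_⟩
  rw [← lintegral_toLp fun x => ‖u x‖ₑ ^ (2 * p - 2)]
  refine hsob.trans ?_
  rw [hsum, hgrad]
  gcongr

end Assembly

end Auxiliary

/-- **Hardy–Sobolev–Maz'ya inequality on convex domains** with a uniform constant: for `N ≥ 3`
there is `σ_N > 0`, depending only on `N`, such that for every open convex set `Ω ⊊ ℝ^N` and
every `u ∈ C_0^∞(Ω)`,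
`∫_Ω (|∇u|² − |u|²/(4 dist(x,Ωᶜ)²)) dx ≥ σ_N (∫_Ω |u|^{2N/(N−2)} dx)^{(N−2)/N}`. -/
theorem hardy_sobolev_mazya_convex (N : ℕ) (hN : 3 ≤ N) :
    ∃ σ : ℝ, 0 < σ ∧
      ∀ (Ω : Set (EuclideanSpace ℝ (Fin N))), IsOpen Ω → Convex ℝ Ω → Ω ≠ Set.univ →
        ∀ u : EuclideanSpace ℝ (Fin N) → ℝ,
          ContDiff ℝ (⊤ : ℕ∞) u → HasCompactSupport u → tsupport u ⊆ Ω →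
          σ * (∫ x in Ω, |u x| ^ (2 * (N : ℝ) / ((N : ℝ) - 2))) ^ (((N : ℝ) - 2) / (N : ℝ)) ≤
            ∫ x in Ω, (‖fderiv ℝ u x‖ ^ 2 - u x ^ 2 / (4 * Metric.infDist x Ωᶜ ^ 2)) := by
  have hN' : (3 : ℝ) ≤ N := by exact_mod_cast hN
  obtain ⟨K, hK, hmain⟩ := hardy_sobolev_lintegral hN
  refine ⟨(K.toReal + 1)⁻¹, by positivity, fun Ω hΩ hΩc hΩne u hu hcs hsupp => ?_⟩
  obtain ⟨hhardy, hsob⟩ := hmain Ω hΩ hΩc hΩne u (hu.of_le (by exact_mod_cast le_top)) hcs hsupp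
  have hu0 : ∀ x ∉ Ω, u x = 0 := fun x hx => image_eq_zero_of_notMem_tsupport fun h => hx (hsupp h)
  have hdu0 : ∀ x ∉ Ω, fderiv ℝ u x = 0 := fun x hx =>
    image_eq_zero_of_notMem_tsupport fun h => hx (hsupp (tsupport_fderiv_subset ℝ h))
  have hdu : Continuous (fderiv ℝ u) := hu.continuous_fderiv (by simp)
  have hr : 0 < 2 * (N : ℝ) / (N - 2) := div_pos (by linarith) (by linarith)
  rw [setIntegral_eq_integral_of_forall_compl_eq_zero fun x hx => by
      rw [hu0 x hx, abs_zero, Real.zero_rpow hr.ne'],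
    setIntegral_eq_integral_of_forall_compl_eq_zero fun x hx => by
      rw [hu0 x hx, hdu0 x hx]; simp]
  have eG : ∀ x, ENNReal.ofReal (‖fderiv ℝ u x‖ ^ 2) = ‖fderiv ℝ u x‖ₑ ^ 2 := fun x => by
    rw [ENNReal.ofReal_pow (norm_nonneg _), ofReal_norm]
  have eH : ∀ x, ENNReal.ofReal (u x ^ 2 / (4 * infDist x Ωᶜ ^ 2)) =
      ‖u x‖ₑ ^ 2 * (4⁻¹ * ENNReal.ofReal ((infDist x Ωᶜ ^ 2)⁻¹)) := fun x => by
    rw [div_eq_mul_inv, ENNReal.ofReal_mul (sq_nonneg _), mul_inv,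
      ENNReal.ofReal_mul (by norm_num), Real.enorm_eq_ofReal_abs,
      ← ENNReal.ofReal_pow (abs_nonneg _), sq_abs, ENNReal.ofReal_inv_of_pos (by norm_num)]
    norm_num
  have eS : ∀ x, ENNReal.ofReal (|u x| ^ (2 * (N : ℝ) / (N - 2))) =
      ‖u x‖ₑ ^ (2 * (N : ℝ) / (N - 2)) := fun x => by
    rw [Real.enorm_eq_ofReal_abs, ENNReal.ofReal_rpow_of_nonneg (abs_nonneg _) hr.le]
  have hGint : Integrable fun x => ‖fderiv ℝ u x‖ ^ 2 :=
    Continuous.integrable_of_hasCompactSupport (by fun_prop)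
      ((hcs.fderiv ℝ).comp_left (g := fun l => ‖l‖ ^ 2) (by simp))
  have hGtop : ∫⁻ x, ‖fderiv ℝ u x‖ₑ ^ 2 ≠ ⊤ := by
    simp only [← eG]
    exact hGint.lintegral_lt_top.ne
  have hHm : Measurable fun x => u x ^ 2 / (4 * infDist x Ωᶜ ^ 2) :=
    (hu.continuous.measurable.pow_const 2).div
      ((measurable_infDist.pow_const 2).const_mul 4)
  have hH0 : ∀ x, 0 ≤ u x ^ 2 / (4 * infDist x Ωᶜ ^ 2) := fun x => by positivity
  have hHint : Integrable fun x => u x ^ 2 / (4 * infDist x Ωᶜ ^ 2) := by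
    refine ⟨hHm.aestronglyMeasurable, ?_⟩
    rw [hasFiniteIntegral_iff_ofReal (Filter.Eventually.of_forall hH0)]
    simp only [eH]
    exact hhardy.trans_lt hGtop.lt_top
  rw [integral_sub hGint hHint,
    integral_eq_lintegral_of_nonneg_ae (Filter.Eventually.of_forall fun x => by positivity)
      hGint.aestronglyMeasurable,
    integral_eq_lintegral_of_nonneg_ae (Filter.Eventually.of_forall hH0)
      hHint.aestronglyMeasurable,
    integral_eq_lintegral_of_nonneg_ae (Filter.Eventually.of_forall fun x => by positivity)
      ((hu.continuous.abs.rpow_const fun x => Or.inr hr.le).aestronglyMeasurable)]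
  simp only [eG, eH, eS]
  rw [← ENNReal.toReal_sub_of_le hhardy hGtop, ENNReal.toReal_rpow,
    inv_mul_le_iff₀ (by positivity)]
  calc _ ≤ (K * ((∫⁻ x, ‖fderiv ℝ u x‖ₑ ^ 2) -
        ∫⁻ x, ‖u x‖ₑ ^ 2 * (4⁻¹ * ENNReal.ofReal ((infDist x Ωᶜ ^ 2)⁻¹)))).toReal :=
      ENNReal.toReal_mono
        (ENNReal.mul_ne_top hK (ne_top_of_le_ne_top hGtop tsub_le_self)) hsob
    _ ≤ _ := by
      rw [ENNReal.toReal_mul]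
      gcongr
      linarith
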